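/- Let N ≥ 1, k ≥ 1, let f be a modular form of weight k on Γ₁(N), and let g = (A, B; C, D) ∈ SL₂(ℤ). Set M = N/gcd(C, N). Then every Fourier coefficient of f |_k g (in its expansion Σ_{n≥0} c_n e^{2πinτ/N}) lies in the subfield K_f(ζ_M) of ℂ generated by K_f and ζ_M. -/

import Mathlib

open Complex UpperHalfPlane CongruenceSubgroup
open scoped ModularForm MatrixGroups Real

noncomputable section

/-- `ζ_N = e^{2πi/N}`. -/
def zetaC (N : ℕ) : ℂ := Complex.exp (2 * Real.pi * Complex.I / N)

/-- `f` has the Fourier expansion `Σ_{n ≥ 0} c n · e^{2πinτ/N}`. -/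
def HasExpansion (N : ℕ) (f : ℍ → ℂ) (c : ℕ → ℂ) : Prop :=
  ∀ τ : ℍ, HasSum (fun n : ℕ => c n * Complex.exp (2 * Real.pi * Complex.I * n * (τ : ℂ) / N)) (f τ)

open PowerSeries in
/-- power series version of expansions -/
def HE (N : ℕ) (F : ℍ → ℂ) (c : PowerSeries ℂ) : Prop :=
  ∀ τ : ℍ, HasSum (fun m : ℕ => coeff m c * Function.Periodic.qParam (N : ℝ) τ ^ m) (F τ)

lemma HE_iff (N : ℕ) (F : ℍ → ℂ) (c : ℕ → ℂ) :
    HasExpansion N F c ↔ HE N F (PowerSeries.mk c) := by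
  unfold HasExpansion HE
  refine forall_congr' fun τ => ?_
  have : (fun n : ℕ => c n * Complex.exp (2 * Real.pi * Complex.I * n * (τ : ℂ) / N)) =
      (fun m : ℕ => PowerSeries.coeff m (PowerSeries.mk c) *
        Function.Periodic.qParam (N : ℝ) τ ^ m) := by
    funext m
    rw [PowerSeries.coeff_mk, Function.Periodic.qParam, ← Complex.exp_nat_mul]
    congr 2
    push_cast
    ring
  rw [this]

lemma exists_qParam {N : ℕ} (hN : 0 < N) {r : ℝ} (hr : 0 < r) (hr1 : r < 1) :
    ∃ τ : ℍ, Function.Periodic.qParam (N : ℝ) τ = r := by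
  have hN' : (0 : ℝ) < N := by exact_mod_cast hN
  have hpos : 0 < -Real.log r * N / (2 * π) := by
    have := Real.log_neg hr hr1
    have : 0 < -Real.log r := by linarith
    positivity
  refine ⟨⟨(-Real.log r * N / (2 * π) : ℝ) * Complex.I, by
    rw [Complex.im_ofReal_mul, Complex.I_im, mul_one]; exact hpos⟩, ?_⟩
  have : Function.Periodic.qParam (N : ℝ) ((-Real.log r * N / (2 * π) : ℝ) * Complex.I) = r := by
    rw [Function.Periodic.qParam]
    have e : 2 * (π : ℂ) * Complex.I * (((-Real.log r * N / (2 * π) : ℝ) : ℂ) * Complex.I) / (N : ℝ)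
        = (Real.log r : ℝ) := by
      have h1 : (N : ℂ) ≠ 0 := by exact_mod_cast hN.ne'
      have h2 : (π : ℂ) ≠ 0 := by exact_mod_cast Real.pi_ne_zero
      push_cast
      field_simp
      rw [Complex.I_sq]; ring
    rw [e, ← Complex.ofReal_exp, Real.exp_log hr]
  exact this

lemma HE.summable_norm {N : ℕ} (hN : 0 < N) {F : ℍ → ℂ} {c : PowerSeries ℂ} (h : HE N F c)
    {r : ℝ} (hr : 0 < r) (hr1 : r < 1) : Summable fun m => ‖PowerSeries.coeff m c‖ * r ^ m := by
  obtain ⟨τ, hτ⟩ := exists_qParam hN hr hr1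
  have := (h τ).summable.norm
  simpa [hτ, abs_of_pos hr] using this

lemma HE.summable_norm' {N : ℕ} {F : ℍ → ℂ} {c : PowerSeries ℂ} (h : HE N F c)
    (τ : ℍ) : Summable fun m => ‖PowerSeries.coeff m c * Function.Periodic.qParam (N : ℝ) τ ^ m‖ :=
  (h τ).summable.norm

lemma HE.mdiff {N : ℕ} (hN : 0 < N) {F : ℍ → ℂ} {c : PowerSeries ℂ} (h : HE N F c) :
    MDifferentiable (modelWithCornersSelf ℂ ℂ) (modelWithCornersSelf ℂ ℂ) F := by
  have hN' : (0 : ℝ) < N := by exact_mod_cast hN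
  rw [UpperHalfPlane.mdifferentiable_iff]
  have hG : ∀ z : ℂ, ‖z‖ < 1 → DifferentiableAt ℂ
      (fun z => ∑' m, PowerSeries.coeff m c * z ^ m) z := by
    intro z hz
    obtain ⟨r, hr1, hr2⟩ := exists_between hz
    have hr0 : 0 < r := (norm_nonneg z).trans_lt hr1
    have := differentiableOn_tsum_of_summable_norm (F := fun (m : ℕ) z => PowerSeries.coeff m c * z ^ m)
      (U := Metric.ball (0 : ℂ) r) (h.summable_norm hN hr0 hr2) (fun i => by fun_prop)
      Metric.isOpen_ball (fun i w hw => by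
        rw [norm_mul, norm_pow]
        have : ‖w‖ ≤ r := by simpa using (mem_ball_zero_iff.1 hw).le
        gcongr)
    exact this.differentiableAt (Metric.isOpen_ball.mem_nhds (by simpa using hr1))
  intro z hz
  have e : Set.EqOn (F ∘ ofComplex) ((fun z => ∑' m, PowerSeries.coeff m c * z ^ m) ∘
      Function.Periodic.qParam (N : ℝ)) {z | 0 < z.im} := by
    intro w hw
    have := (h ⟨w, hw⟩).tsum_eq
    simp only [Function.comp]
    rw [ofComplex_apply_of_im_pos hw, ← this]
  refine DifferentiableWithinAt.congr ?_ e (e hz)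
  refine (DifferentiableAt.comp z (hG _ (Function.Periodic.norm_qParam_lt_one hN' hz)) ?_).differentiableWithinAt
  exact (Function.Periodic.differentiable_qParam).differentiableAt

lemma HE.bdd {N : ℕ} (hN : 0 < N) {F : ℍ → ℂ} {c : PowerSeries ℂ} (h : HE N F c) :
    IsBoundedAtImInfty F :=
  isBoundedAtImInfty_of_hasSum_qExpansion (h := (N : ℝ)) (by exact_mod_cast hN)
    (c := fun m => PowerSeries.coeff m c) h

lemma HE.periodic {N : ℕ} (hN : 0 < N) {F : ℍ → ℂ} {c : PowerSeries ℂ} (h : HE N F c) :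
    Function.Periodic (F ∘ ofComplex) (N : ℝ) := by
  have hN' : ((N : ℝ) : ℂ) ≠ 0 := by exact_mod_cast hN.ne'
  intro z
  simp only [Function.comp]
  by_cases hz : 0 < z.im
  · have hz' : 0 < (z + (N : ℝ)).im := by simpa using hz
    rw [ofComplex_apply_of_im_pos hz, ofComplex_apply_of_im_pos hz']
    refine (h ⟨z + (N : ℝ), hz'⟩).unique ?_
    convert! h ⟨z, hz⟩ using 3
    have e : Function.Periodic.qParam (N : ℝ) (z + (N : ℝ)) = Function.Periodic.qParam (N : ℝ) z := by
      rw [Function.Periodic.qParam, Function.Periodic.qParam, mul_add, add_div,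
        mul_div_cancel_right₀ _ hN', Complex.exp_periodic _]
    exact congrArg (· ^ _) e
  · have hz' : ¬ 0 < (z + (N : ℝ)).im := by simpa using hz
    rw [ofComplex_apply_of_im_nonpos (not_lt.1 hz), ofComplex_apply_of_im_nonpos (not_lt.1 hz')]

lemma HE.unique {N : ℕ} (hN : 0 < N) {F : ℍ → ℂ} {c c' : PowerSeries ℂ} (h : HE N F c)
    (h' : HE N F c') : c = c' := by
  have hN' : (0 : ℝ) < N := by exact_mod_cast hN
  refine PowerSeries.ext fun m => ?_
  have h0 := analyticAt_cuspFunction_zero hN' (h.periodic hN) (h.mdiff hN) (h.bdd hN)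
  have h1 := (hasFPowerSeriesOnBall_cuspFunction (c := fun m => PowerSeries.coeff m c)
    hN' h0 h).hasFPowerSeriesAt
  have h2 := (hasFPowerSeriesOnBall_cuspFunction (c := fun m => PowerSeries.coeff m c')
    hN' h0 h').hasFPowerSeriesAt
  simpa using congr_arg (FormalMultilinearSeries.coeff · m) (h1.eq_formalMultilinearSeries h2)

lemma HE.const (N : ℕ) (a : ℂ) : HE N (fun _ => a) (PowerSeries.C a) := by
  intro τ
  have := hasSum_single (f := fun m : ℕ => PowerSeries.coeff m (PowerSeries.C a) *
    Function.Periodic.qParam (N : ℝ) τ ^ m) 0 (by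
      intro b hb; simp [PowerSeries.coeff_C, hb])
  simpa using this

lemma HE.add {N : ℕ} {F G : ℍ → ℂ} {c d : PowerSeries ℂ} (h : HE N F c) (h' : HE N G d) :
    HE N (F + G) (c + d) := by
  intro τ
  simpa [add_mul] using (h τ).add (h' τ)

lemma HE.neg {N : ℕ} {F : ℍ → ℂ} {c : PowerSeries ℂ} (h : HE N F c) :
    HE N (-F) (-c) := by
  intro τ
  simpa using (h τ).neg

lemma HE.mul {N : ℕ} {F G : ℍ → ℂ} {c d : PowerSeries ℂ} (h : HE N F c) (h' : HE N G d) :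
    HE N (F * G) (c * d) := by
  intro τ
  have h1 := h.summable_norm' τ
  have h2 := h'.summable_norm' τ
  have := tsum_mul_tsum_eq_tsum_sum_antidiagonal_of_summable_norm h1 h2
  rw [(h τ).tsum_eq, (h' τ).tsum_eq] at this
  have s := (summable_norm_sum_mul_antidiagonal_of_summable_norm h1 h2).of_norm
  have e : (fun m => PowerSeries.coeff m (c * d) * Function.Periodic.qParam (N : ℝ) τ ^ m) =
    fun n => ∑ kl ∈ Finset.HasAntidiagonal.antidiagonal n, PowerSeries.coeff kl.1 c * Function.Periodic.qParam (N : ℝ) τ ^ kl.1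
      * (PowerSeries.coeff kl.2 d * Function.Periodic.qParam (N : ℝ) τ ^ kl.2) := by
    funext m
    rw [PowerSeries.coeff_mul, Finset.sum_mul]
    refine Finset.sum_congr rfl fun x hx => ?_
    rw [← Finset.HasAntidiagonal.mem_antidiagonal.1 hx, pow_add]; ring
  rw [e]
  simpa [this] using s.hasSum

/-- pairs of functions and expansions -/
def Good (N : ℕ) : Subring ((ℍ → ℂ) × PowerSeries ℂ) where
  carrier := {p | HE N p.1 p.2}
  mul_mem' := fun h h' => h.mul h'
  one_mem' := by have := HE.const N 1; rw [map_one] at this; exact this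
  add_mem' := fun h h' => h.add h'
  zero_mem' := by have := HE.const N 0; rw [map_zero] at this; exact this
  neg_mem' := fun h => h.neg

/-- first projection -/
def gF (N : ℕ) : Good N →+* (ℍ → ℂ) := (RingHom.fst _ _).comp (Good N).subtype
/-- second projection -/
def gS (N : ℕ) : Good N →+* PowerSeries ℂ := (RingHom.snd _ _).comp (Good N).subtype

lemma gHE {N : ℕ} (x : Good N) : HE N (gF N x) (gS N x) := x.2

lemma gS_inj (N : ℕ) : Function.Injective (gS N) := by
  intro x y h
  refine Subtype.ext (Prod.ext ?_ h)
  funext τ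
  have h1 := gHE x τ
  have h2 := gHE y τ
  rw [h] at h1
  exact h1.unique h2

lemma gF_inj {N : ℕ} (hN : 0 < N) : Function.Injective (gF N) := by
  intro x y h
  refine Subtype.ext (Prod.ext h ?_)
  have h1 := gHE x
  have h2 := gHE y
  rw [h] at h1
  exact h1.unique hN h2

lemma HE.expand {N d : ℕ} (hN : 0 < N) (hd : d ≠ 0) {F : ℍ → ℂ} {c : PowerSeries ℂ} (h : HE N F c) :
    HE (d * N) F (PowerSeries.expand d hd c) := by
  intro τ
  have inj : Function.Injective (fun m : ℕ => d * m) := fun a b hab =>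
    Nat.eq_of_mul_eq_mul_left (Nat.pos_of_ne_zero hd) hab
  rw [← inj.hasSum_iff]
  · convert! h τ using 2 with m
    simp only [Function.comp]
    rw [PowerSeries.coeff_expand_mul, pow_mul, Function.Periodic.qParam, Function.Periodic.qParam,
      ← Complex.exp_nat_mul]
    congr 3
    have : (d : ℂ) ≠ 0 := by exact_mod_cast hd
    have : (N : ℂ) ≠ 0 := by exact_mod_cast hN.ne'
    push_cast
    field_simp
  · intro m hm
    rw [PowerSeries.coeff_expand_of_not_dvd, zero_mul]
    rintro ⟨k, rfl⟩
    exact hm ⟨k, rfl⟩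

lemma HE_levelOne {m : ℤ} (F : ModularForm 𝒮ℒ m) : HE 1 F (qExpansion 1 F) := by
  intro τ
  have := ModularForm.hasSum_qExpansion F one_pos one_mem_strictPeriods_SL τ
  simpa using this

lemma levelOne_ext {m : ℤ} {F G : ModularForm 𝒮ℒ m} (h : (F : ℍ → ℂ) = G) : F = G :=
  DFunLike.coe_injective h

lemma map_sigma_E (σ : ℂ →+* ℂ) {k : ℕ} (hk : 3 ≤ k) (hk2 : Even k) :
    PowerSeries.map σ (qExpansion 1 (ModularForm.E hk)) = qExpansion 1 (ModularForm.E hk) := by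
  refine PowerSeries.ext fun m => ?_
  rw [PowerSeries.coeff_map, EisensteinSeries.E_qExpansion_coeff hk hk2]
  have h2 : σ 2 = 2 := map_ofNat σ 2
  split_ifs <;> simp [h2]

lemma HE_smul {N : ℕ} {F : ℍ → ℂ} {c : PowerSeries ℂ} (h : HE N F c) (a : ℂ) :
    HE N (a • F) (PowerSeries.C a * c) := (HE.const N a).mul h

lemma HE_discriminant : HE 1 ModularForm.discriminant
    (PowerSeries.C (1728⁻¹ : ℂ) * (qExpansion 1 ModularForm.E₄ ^ 3 - qExpansion 1 ModularForm.E₆ ^ 2)) := by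
  have h4 := HE_levelOne ModularForm.E₄
  have h6 := HE_levelOne ModularForm.E₆
  have := HE_smul (((h4.mul h4).mul h4).add ((h6.mul h6).neg)) (1728⁻¹ : ℂ)
  convert! this using 1
  · funext z
    rw [ModularForm.discriminant_eq_E₄_cube_sub_E₆_sq]
    simp
    ring
  · ring

lemma levelOne_sigma_aux (σ : ℂ →+* ℂ) : ∀ n : ℕ, ∀ m : ℤ, m < n → ∀ F : ModularForm 𝒮ℒ m,
    ∃ F' : ModularForm 𝒮ℒ m, HE 1 F' (PowerSeries.map σ (qExpansion 1 F)) := by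
  have hz : ∀ m : ℤ, ∀ F : ModularForm 𝒮ℒ m, F = 0 →
    ∃ F' : ModularForm 𝒮ℒ m, HE 1 F' (PowerSeries.map σ (qExpansion 1 F)) := by
    rintro m F rfl
    refine ⟨0, ?_⟩
    have : qExpansion 1 (⇑(0 : ModularForm 𝒮ℒ m)) = 0 := qExpansion_zero 1
    rw [this, map_zero]
    have := HE.const 1 0
    rw [map_zero] at this
    exact this
  intro n
  induction n with
  | zero =>
    intro m hm F
    apply hz
    exact levelOne_ext (ModularFormClass.levelOne_neg_weight_eq_zero (by exact_mod_cast hm) F)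
  | succ n ih =>
    intro m hm F
    rcases lt_or_ge m 0 with h0 | h0
    · exact hz _ _ (levelOne_ext (ModularFormClass.levelOne_neg_weight_eq_zero h0 F))
    rcases Int.even_or_odd m with he | ho
    swap
    · exact hz _ _ (ModularForm.levelOne_odd_weight_eq_zero ho F)
    obtain ⟨k, rfl⟩ := Int.eq_ofNat_of_zero_le h0
    have hke : Even k := by exact_mod_cast he
    rcases Nat.eq_zero_or_pos k with rfl | hkpos
    · obtain ⟨c, hc⟩ := ModularFormClass.levelOne_weight_zero_const F
      refine ⟨ModularForm.mcast rfl (ModularForm.const (σ c)), ?_⟩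
      have h1 := HE_levelOne F
      rw [hc] at h1
      have h2 := h1.unique one_pos (HE.const 1 c)
      rw [hc, h2, PowerSeries.map_C]
      exact HE.const 1 (σ c)
    by_cases hk2 : k = 2
    · subst hk2
      apply hz
      exact (rank_zero_iff_forall_zero.1 ModularForm.levelOne_weight_two_rank_zero) F
    have hk : 3 ≤ k := by
      rcases hke with ⟨r, rfl⟩; omega
    set a := (qExpansion 1 F).coeff 0 with ha
    set G : ModularForm 𝒮ℒ k := F - a • ModularForm.E hk with hG
    have hGE : (F : ℍ → ℂ) = G + a • (ModularForm.E hk : ℍ → ℂ) := by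
      rw [hG]; funext z; simp
    have hq : qExpansion 1 F = qExpansion 1 G + PowerSeries.C a * qExpansion 1 (ModularForm.E hk) := by
      refine (HE_levelOne F).unique one_pos ?_
      rw [hGE]
      exact (HE_levelOne G).add (HE_smul (HE_levelOne _) a)
    have hG0 : (qExpansion 1 G).coeff 0 = 0 := by
      have := congrArg (PowerSeries.coeff 0) hq
      rw [map_add, PowerSeries.coeff_C_mul, EisensteinSeries.E_qExpansion_coeff_zero hk hke, ← ha] at this
      simpa using this
    set H := CuspForm.discriminantEquiv (ModularForm.toCuspForm G hG0) with hH
    obtain ⟨H', hH'⟩ := ih ((k : ℤ) - 12) (by push_cast at hm ⊢; omega) H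
    refine ⟨(CuspForm.ofMulDiscriminant H' : ModularForm 𝒮ℒ k) + (σ a) • ModularForm.E hk, ?_⟩
    have e1 : qExpansion 1 G = (PowerSeries.C (1728⁻¹ : ℂ) * (qExpansion 1 ModularForm.E₄ ^ 3 - qExpansion 1 ModularForm.E₆ ^ 2)) * qExpansion 1 H := by
      refine (HE_levelOne G).unique one_pos ?_
      have := HE_discriminant.mul (HE_levelOne H)
      rw [hH, ModularForm.discriminant_mul_discriminantEquiv] at this
      exact this
    rw [hq, e1]
    simp only [map_add, map_mul, map_sub, map_pow, PowerSeries.map_C, map_sigma_E σ hk hke]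
    have e4 : PowerSeries.map σ (qExpansion 1 ModularForm.E₄) = qExpansion 1 ModularForm.E₄ :=
      map_sigma_E σ _ ⟨2, rfl⟩
    have e6 : PowerSeries.map σ (qExpansion 1 ModularForm.E₆) = qExpansion 1 ModularForm.E₆ :=
      map_sigma_E σ _ ⟨3, rfl⟩
    rw [e4, e6]
    have h1728 : σ (1728⁻¹ : ℂ) = 1728⁻¹ := by
      rw [map_inv₀, show σ 1728 = 1728 from map_ofNat σ 1728]
    rw [h1728]
    exact (HE_discriminant.mul hH').add (HE_smul (HE_levelOne _) (σ a))

lemma levelOne_sigma (σ : ℂ →+* ℂ) {m : ℤ} (F : ModularForm 𝒮ℒ m) :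
    ∃ F' : ModularForm 𝒮ℒ m, HE 1 F' (PowerSeries.map σ (qExpansion 1 F)) := by
  refine levelOne_sigma_aux σ (m.toNat + 1) m ?_ F
  push_cast
  omega

/-- a function with an expansion that is `SL₂(ℤ)`-invariant is a level one form -/
lemma exists_levelOne {N : ℕ} (hN : 0 < N) {m : ℤ} {F : ℍ → ℂ} {c : PowerSeries ℂ} (h : HE N F c)
    (hF : ∀ γ : SL(2, ℤ), F ∣[m] γ = F) : ∃ G : ModularForm 𝒮ℒ m, (G : ℍ → ℂ) = F := by
  refine ⟨{ toFun := F
            slash_action_eq' := fun _ ⟨γ, hγ⟩ ↦ hγ ▸ hF γ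
            holo' := h.mdiff hN
            bdd_at_cusps' := ?_ }, rfl⟩
  intro c hc
  rw [Subgroup.IsArithmetic.isCusp_iff_isCusp_SL2Z] at hc
  rw [OnePoint.isBoundedAt_iff_forall_SL2Z hc]
  intro γ _
  change IsBoundedAtImInfty (F ∣[m] γ)
  rw [hF γ]
  exact h.bdd hN

/-- conjugation of an invariant function with expansion. -/
lemma exists_conj (σ : ℂ →+* ℂ) {N : ℕ} (hN : 0 < N) {m : ℤ} {F : ℍ → ℂ} {c : PowerSeries ℂ}
    (h : HE N F c) (hF : ∀ γ : SL(2, ℤ), F ∣[m] γ = F) :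
    ∃ G : ℍ → ℂ, HE N G (PowerSeries.map σ c) ∧ ∀ γ : SL(2, ℤ), G ∣[m] γ = G := by
  obtain ⟨G, rfl⟩ := exists_levelOne hN h hF
  obtain ⟨G', hG'⟩ := levelOne_sigma σ G
  refine ⟨G', ?_, fun γ => ?_⟩
  · have h1 := (HE_levelOne G).expand one_pos hN.ne'
    have h2 := hG'.expand one_pos hN.ne'
    rw [mul_one] at h1 h2
    rw [h.unique hN h1]
    convert! h2 using 1
    refine PowerSeries.ext fun n => ?_
    rw [PowerSeries.coeff_map, PowerSeries.coeff_expand, PowerSeries.coeff_expand]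
    split_ifs <;> simp
  · rw [ModularForm.SL_slash]
    exact SlashInvariantFormClass.slash_action_eq G' _ ⟨γ, rfl⟩

section Eis

variable {N : ℕ} [NeZero N]

/-- standard additive character -/
def ee (b : ZMod N) : ℂ := ZMod.stdAddChar b

lemma ee_int (j : ℤ) : ee (j : ZMod N) = Complex.exp (2 * π * Complex.I * j / N) :=
  ZMod.stdAddChar_coe j

lemma ee_mul_nat (b : ZMod N) (m : ℕ) : ee (b * (m : ZMod N)) = ee b ^ m := by
  have := AddChar.map_nsmul_eq_pow (ZMod.stdAddChar (N := N)) m b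
  rw [nsmul_eq_mul, mul_comm] at this
  exact this

lemma ee_add (a b : ZMod N) : ee (a + b) = ee a * ee b := AddChar.map_add_eq_mul _ a b

lemma ee_inj : Function.Injective (ee (N := N)) := ZMod.injective_stdAddChar

lemma ee_norm (b : ZMod N) : ‖ee b‖ = 1 := by
  have : ee b = (ZMod.toCircle b : ℂ) := ZMod.stdAddChar_apply b
  rw [this]; exact Circle.norm_coe _

/-- row sums -/
def row (b : ZMod N) (c : ℤ) (τ : ℍ) : ℂ :=
  ∑' d : ℤ, if (d : ZMod N) = b then ((c : ℂ) * τ + d) ^ (-3 : ℤ) else 0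

/-- normalising constant -/
def nrm (N : ℕ) : ℂ := (N : ℂ) ^ 3 / ((-2 * π * Complex.I) ^ 3 / 2)

lemma row_neg (b : ZMod N) (c : ℤ) (τ : ℍ) : row b (-c) τ = - row (-b) c τ := by
  unfold row
  rw [← (Equiv.neg ℤ).tsum_eq, ← tsum_neg]
  refine tsum_congr fun d => ?_
  simp only [Equiv.neg_apply, Int.cast_neg, neg_eq_iff_eq_neg]
  split_ifs
  · rw [show (-(c : ℂ) * τ + -d) = -((c : ℂ) * τ + d) by ring, Odd.neg_zpow (by decide)]
  · simp

lemma tsum_class (b : ZMod N) (g : ℤ → ℂ) :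
    (∑' d : ℤ, if (d : ZMod N) = b then g d else 0) = ∑' n : ℤ, g (b.val + N * n) := by
  have inj : Function.Injective (fun n : ℤ => (b.val : ℤ) + N * n) := by
    intro x y h
    have hN : (N : ℤ) ≠ 0 := by exact_mod_cast NeZero.ne N
    exact mul_left_cancel₀ hN (add_left_cancel h)
  rw [← inj.tsum_eq]
  · refine tsum_congr fun n => ?_
    rw [if_pos (by simp)]
  · intro d hd
    rw [Function.mem_support] at hd
    have : (d : ZMod N) = b := by
      by_contra h; rw [if_neg h] at hd; exact hd rfl
    have h2 : ((d - b.val : ℤ) : ZMod N) = 0 := by simp [this]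
    rw [ZMod.intCast_zmod_eq_zero_iff_dvd] at h2
    obtain ⟨n, hn⟩ := h2
    exact ⟨n, by simp only; omega⟩

lemma qP_ne (τ : ℍ) :
    Function.Periodic.qParam (N : ℝ) τ = Complex.exp (2 * π * Complex.I * τ / N) := by
  simp [Function.Periodic.qParam]

lemma qP_norm (τ : ℍ) : ‖Function.Periodic.qParam (N : ℝ) τ‖ < 1 :=
  Function.Periodic.norm_qParam_lt_one (by exact_mod_cast NeZero.pos N) τ.im_pos

lemma row_lipschitz (b : ZMod N) (c : ℕ+) (τ : ℍ) :
    nrm N * row b c τ = ∑' m : ℕ+, ((m : ℕ) : ℂ) ^ 2 * ee (b * ((m : ℕ) : ZMod N)) *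
      Function.Periodic.qParam (N : ℝ) τ ^ ((c : ℕ) * m) := by
  have hN : (N : ℂ) ≠ 0 := by exact_mod_cast NeZero.ne N
  have hNp : (0 : ℝ) < N := by exact_mod_cast NeZero.pos N
  have hz : 0 < (((c : ℕ) * (τ : ℂ) + b.val) / N).im := by
    have h1 : (((c : ℕ) * (τ : ℂ) + b.val) / N).im = (c : ℕ) * τ.im / N := by
      rw [Complex.div_natCast_im]
      simp [-ZMod.natCast_val]
    rw [h1]
    have := τ.im_pos
    have hc : (0 : ℝ) < (c : ℕ) := by exact_mod_cast c.pos
    positivity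
  have h := EisensteinSeries.qExpansion_identity (k := 2) (by norm_num) ⟨_, hz⟩
  have h1 : row b c τ = ((N : ℂ) ^ 3)⁻¹ * ∑' n : ℤ, 1 / ((((c : ℕ) * (τ : ℂ) + b.val) / N) + n) ^ (2 + 1) := by
    unfold row
    rw [tsum_class, ← tsum_mul_left]
    refine tsum_congr fun n => ?_
    rw [zpow_neg, one_div, ← mul_inv]
    congr 1
    rw [← mul_pow]
    norm_cast
    congr 1
    push_cast
    field_simp
    ring
  have hC : ((-2 * (π : ℂ) * Complex.I) ^ 3 / 2) ≠ 0 := by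
    have := Real.pi_ne_zero
    simp [this]
  rw [h1]
  change _ * (_ * ∑' n : ℤ, 1 / (((⟨_, hz⟩ : ℍ) : ℂ) + n) ^ (2 + 1)) = _
  rw [h]
  unfold nrm
  have h2 : (∑' n : ℕ, (n : ℂ) ^ 2 * Complex.exp (2 * π * Complex.I * ((⟨_, hz⟩ : ℍ) : ℂ)) ^ n) =
    ∑' m : ℕ+, ((m : ℕ) : ℂ) ^ 2 * ee (b * ((m : ℕ) : ZMod N)) *
      Function.Periodic.qParam (N : ℝ) τ ^ ((c : ℕ) * m) := by
    rw [← (PNat.coe_injective).tsum_eq]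
    swap
    · intro n hn
      have : n ≠ 0 := by rintro rfl; simp at hn
      exact ⟨⟨n, Nat.pos_of_ne_zero this⟩, rfl⟩
    refine tsum_congr fun m => ?_
    conv_rhs => rw [mul_assoc]
    congr 1
    rw [ee_mul_nat, pow_mul, ← mul_pow]
    congr 1
    rw [qP_ne, ← Complex.exp_nat_mul]
    have : ee b = Complex.exp (2 * π * Complex.I * b.val / N) := by
      have := ee_int (N := N) b.val
      simpa using this
    rw [this, ← Complex.exp_add]
    congr 1
    change 2 * π * Complex.I * (((c : ℕ) * (τ : ℂ) + b.val) / N) = _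
    field_simp
    ring
  rw [h2]
  simp only [Nat.factorial]
  push_cast
  field_simp

/-- the constant terms -/
def Kc (b : ZMod N) : ℂ :=
  ((N : ℂ) ^ 2 / 3) * ∑ j : ZMod N, ee (-(j * b)) *
    (((Polynomial.bernoulli 3).eval ((j.val : ℚ) / N) : ℚ) : ℂ)

lemma row_zero (b : ZMod N) (τ : ℍ) : nrm N * row b 0 τ = Kc b := by
  have hN : (N : ℂ) ≠ 0 := by exact_mod_cast NeZero.ne N
  have hNp : (0 : ℝ) < N := by exact_mod_cast NeZero.pos N
  have key : ∀ j : ZMod N, HasSum (fun n : ℤ => 1 / (n : ℂ) ^ 3 * ee (j * (n : ZMod N)))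
      (-(2 * π * Complex.I) ^ 3 / 6 * (((Polynomial.bernoulli 3).eval ((j.val : ℚ) / N) : ℚ) : ℂ)) := by
    intro j
    have hx : ((j.val : ℝ) / N) ∈ Set.Icc (0 : ℝ) 1 := by
      refine ⟨by positivity, ?_⟩
      rw [div_le_one hNp]
      exact_mod_cast (ZMod.val_lt j).le
    have := hasSum_one_div_pow_mul_fourier_mul_bernoulliFun (k := 3) (by norm_num) hx
    convert! this using 1
    · funext n
      congr 1
      rw [fourier_coe_apply]
      have := ee_int (N := N) (j.val * n)
      push_cast at this
      rw [ZMod.natCast_zmod_val] at this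
      rw [this]
      congr 1
      push_cast
      field_simp
      
    · congr 1
      rw [bernoulliFun]
      have : ((j.val : ℝ) / N) = algebraMap ℚ ℝ ((j.val : ℚ) / N) := by simp [-ZMod.natCast_val]
      rw [this, Polynomial.eval_map_algebraMap, Polynomial.aeval_algebraMap_apply]
      simp
  have h1 := hasSum_sum (s := Finset.univ) fun j (_ : j ∈ Finset.univ) =>
    ((key j).mul_left ((N : ℂ)⁻¹ * ee (-(j * b))))
  have h2 : row b 0 τ = ∑ j : ZMod N, (N : ℂ)⁻¹ * ee (-(j * b)) * (-(2 * π * Complex.I) ^ 3 / 6 * (((Polynomial.bernoulli 3).eval ((j.val : ℚ) / N) : ℚ) : ℂ)) := by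
    rw [← h1.tsum_eq]
    unfold row
    refine tsum_congr fun d => ?_
    have h3 : ∑ j : ZMod N, ee (j * ((d : ZMod N) - b)) = if (d : ZMod N) = b then (N : ℂ) else 0 := by
      have := AddChar.sum_mulShift ((d : ZMod N) - b) (ZMod.isPrimitive_stdAddChar N)
      simp only [sub_eq_zero, ZMod.card] at this
      unfold ee
      rw [this]
      push_cast
      rfl
    have h4 : ∀ j : ZMod N, (N : ℂ)⁻¹ * ee (-(j * b)) * (1 / (d : ℂ) ^ 3 * ee (j * (d : ZMod N))) =
      ((N : ℂ)⁻¹ * (1 / (d : ℂ) ^ 3)) * ee (j * ((d : ZMod N) - b)) := by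
      intro j
      rw [show j * ((d : ZMod N) - b) = -(j * b) + j * d by ring, ee_add]
      ring
    simp only [h4]
    rw [← Finset.mul_sum, h3]
    split_ifs
    · rw [zpow_neg]
      simp
      field_simp
    · simp
  rw [h2, Kc, nrm, Finset.mul_sum, Finset.mul_sum]
  refine Finset.sum_congr rfl fun j _ => ?_
  have hpi : (π : ℂ) ≠ 0 := by exact_mod_cast Real.pi_ne_zero
  field_simp
  ring_nf
  
/-- raw coefficients -/
def cf (a b : ZMod N) (c m : ℕ) : ℂ :=
  (m : ℂ) ^ 2 * ((if (c : ZMod N) = a then ee (b * (m : ZMod N)) else 0) -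
    (if (c : ZMod N) = -a then ee (-b * (m : ZMod N)) else 0))

/-- formal expansion of Eisenstein series -/
def Hhat (v : ZMod N × ZMod N) : PowerSeries ℂ :=
  PowerSeries.C (if v.1 = 0 then Kc v.2 else 0) +
    PowerSeries.mk fun n => ∑ p ∈ n.divisorsAntidiagonal, cf v.1 v.2 p.1 p.2

/-- Eisenstein series -/
def Hfun (v : ZMod N × ZMod N) (τ : ℍ) : ℂ :=
  nrm N * ∑' x : Fin 2 → ℤ, if ((x 0 : ZMod N), (x 1 : ZMod N)) = v then
    EisensteinSeries.eisSummand 3 x τ else 0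

lemma cf_norm (a b : ZMod N) (c m : ℕ) : ‖cf a b c m‖ ≤ 2 * (m : ℝ) ^ 2 := by
  unfold cf
  rw [norm_mul, norm_pow, Complex.norm_natCast, mul_comm]
  gcongr
  refine (norm_sub_le _ _).trans ?_
  have h : ∀ (p : Prop) [Decidable p] (x : ZMod N), ‖if p then ee x else 0‖ ≤ 1 := by
    intro p _ x
    split_ifs
    · rw [ee_norm]
    · simp
  linarith [h ((c : ZMod N) = a) (b * (m : ZMod N)), h ((c : ZMod N) = -a) (-b * (m : ZMod N))]

lemma Hfun_eq (v : ZMod N × ZMod N) (τ : ℍ) :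
    Hfun v τ = (if v.1 = 0 then Kc v.2 else 0) + ∑' c : ℕ+, ∑' m : ℕ+, cf v.1 v.2 c m *
      Function.Periodic.qParam (N : ℝ) τ ^ ((c : ℕ) * m) := by
  obtain ⟨a, b⟩ := v
  have hs : Summable fun x : ℤ × ℤ => if ((x.1 : ZMod N), (x.2 : ZMod N)) = (a, b) then
    EisensteinSeries.eisSummand 3 ![x.1, x.2] τ else 0 := by
    have := summable_prod_eisSummand (k := 3) le_rfl τ
    refine Summable.of_norm_bounded this.norm ?_
    intro x
    split_ifs
    · rfl
    · simp
  have h1 : (∑' x : Fin 2 → ℤ, if ((x 0 : ZMod N), (x 1 : ZMod N)) = (a, b) then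
    EisensteinSeries.eisSummand 3 x τ else 0) = ∑' x : ℤ × ℤ, if ((x.1 : ZMod N), (x.2 : ZMod N)) = (a, b) then
    EisensteinSeries.eisSummand 3 ![x.1, x.2] τ else 0 := by
    rw [← (finTwoArrowEquiv ℤ).symm.tsum_eq]
    rfl
  have h2 : ∀ c : ℤ, (∑' d : ℤ, if ((c : ZMod N), (d : ZMod N)) = (a, b) then
    EisensteinSeries.eisSummand 3 ![c, d] τ else 0) = if (c : ZMod N) = a then row b c τ else 0 := by
    intro c
    simp only [Prod.mk.injEq]
    split_ifs with h
    · unfold row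
      refine tsum_congr fun d => ?_
      simp [h, EisensteinSeries.eisSummand]
    · simp [h]
  have hs2 : Summable fun c : ℤ => if (c : ZMod N) = a then row b c τ else 0 := by
    have := hs.prod
    simp only [h2] at this
    exact this
  have hs3 : Summable fun c : ℕ+ => if (((c : ℕ) : ℤ) : ZMod N) = a then row b ((c : ℕ) : ℤ) τ else 0 :=
    hs2.comp_injective (i := fun c : ℕ+ => ((c : ℕ) : ℤ)) (fun x y h => by simpa using h)
  have hs4 : Summable fun c : ℕ+ => if ((-((c : ℕ) : ℤ) : ℤ) : ZMod N) = a then row b (-((c : ℕ) : ℤ)) τ else 0 :=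
    hs2.comp_injective (i := fun c : ℕ+ => -((c : ℕ) : ℤ)) (fun x y h => by simpa using h)
  unfold Hfun
  rw [h1, hs.tsum_prod]
  simp only [h2]
  rw [tsum_int_eq_zero_add_tsum_pnat hs2, add_assoc, ← hs3.tsum_add hs4, mul_add, ← tsum_mul_left]
  congr 1
  · simp only [Int.cast_zero, mul_ite, mul_zero, row_zero, eq_comm]
  · refine tsum_congr fun c => ?_
    have hsum : ∀ b : ZMod N, Summable fun m : ℕ+ => ((m : ℕ) : ℂ) ^ 2 * ee (b * ((m : ℕ) : ZMod N)) *
      Function.Periodic.qParam (N : ℝ) τ ^ ((c : ℕ) * m) := by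
      intro b
      have := (summable_prod_mul_pow 2 (qP_norm (N := N) τ)).comp_injective
        (i := fun m : ℕ+ => (c, m)) (fun x y h => by simpa using h)
      refine Summable.of_norm_bounded this.norm ?_
      intro m
      simp [ee_norm]
    have hr := row_lipschitz b c τ
    have hr' := row_lipschitz (-b) c τ
    rw [row_neg, mul_add, mul_ite, mul_ite, mul_neg, mul_zero, hr, hr']
    have e1 : ((((c : ℕ) : ℤ) : ZMod N) = a) ↔ (((c : ℕ) : ZMod N) = a) := by simp
    have e2 : (((-((c : ℕ) : ℤ) : ℤ) : ZMod N) = a) ↔ (((c : ℕ) : ZMod N) = -a) := by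
      simp [neg_eq_iff_eq_neg]
    simp only [e1, e2]
    unfold cf
    by_cases k1 : (((c : ℕ) : ZMod N) = a) <;> by_cases k2 : (((c : ℕ) : ZMod N) = -a)
    · rw [if_pos k1, if_pos k2, ← sub_eq_add_neg, ← (hsum b).tsum_sub (hsum (-b))]
      refine tsum_congr fun m => ?_
      simp only [if_pos k1, if_pos k2]; ring
    · rw [if_pos k1, if_neg k2, add_zero]
      refine tsum_congr fun m => ?_
      simp only [if_pos k1, if_neg k2]; ring
    · rw [if_neg k1, if_pos k2, zero_add, ← tsum_neg]
      refine tsum_congr fun m => ?_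
      simp only [if_neg k1, if_pos k2]; ring
    · simp only [if_neg k1, if_neg k2]; simp

lemma HE_Hfun (v : ZMod N × ZMod N) : HE N (Hfun v) (Hhat v) := by
  rw [show Hfun v = (fun _ => (if v.1 = 0 then Kc v.2 else 0)) + (fun τ : ℍ => ∑' c : ℕ+, ∑' m : ℕ+, cf v.1 v.2 c m *
      Function.Periodic.qParam (N : ℝ) τ ^ ((c : ℕ) * m)) from funext fun τ => Hfun_eq v τ]
  refine (HE.const N _).add ?_
  intro τ
  set q := Function.Periodic.qParam (N : ℝ) τ
  have hs : Summable fun x : ℕ+ × ℕ+ => cf v.1 v.2 x.1 x.2 * q ^ ((x.1 : ℕ) * x.2) := by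
    have := (summable_prod_mul_pow 2 (qP_norm (N := N) τ))
    refine Summable.of_norm_bounded (this.norm.mul_left 2) ?_
    intro x
    rw [norm_mul, norm_mul, norm_pow (((x.2 : ℕ) : ℂ)), Complex.norm_natCast, ← mul_assoc]
    gcongr
    exact cf_norm _ _ _ _
  have h0 := hs.tsum_prod
  simp only at h0 ⊢
  rw [← h0]
  have h1 := hs.hasSum
  rw [← sigmaAntidiagonalEquivProd.hasSum_iff] at h1
  have h2 := h1.sigma (fun n => hasSum_fintype _)
  rw [← (PNat.coe_injective).hasSum_iff]
  · convert! h2 using 1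
    funext n
    simp only [Function.comp, PowerSeries.coeff_mk, Finset.sum_mul]
    rw [← Finset.sum_coe_sort (Nat.divisorsAntidiagonal n)]
    refine Finset.sum_congr rfl fun x _ => ?_
    have := (Nat.mem_divisorsAntidiagonal.1 x.2).1
    simp only [sigmaAntidiagonalEquivProd, divisorsAntidiagonalFactors]
    simp [this]
  · intro n hn
    have : n = 0 := by
      by_contra h
      exact hn ⟨⟨n, Nat.pos_of_ne_zero h⟩, rfl⟩
    subst this
    simp

end Eis

section EisTwo

variable {N : ℕ} [NeZero N]

/-- right action of `SL₂(ℤ)` on row vectors mod `N` -/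
def act (v : ZMod N × ZMod N) (γ : SL(2, ℤ)) : ZMod N × ZMod N :=
  (v.1 * (γ 0 0 : ZMod N) + v.2 * (γ 1 0 : ZMod N), v.1 * (γ 0 1 : ZMod N) + v.2 * (γ 1 1 : ZMod N))

lemma act_mul (v : ZMod N × ZMod N) (γ δ : SL(2, ℤ)) : act v (γ * δ) = act (act v γ) δ := by
  simp only [act, Matrix.SpecialLinearGroup.coe_mul, Matrix.mul_apply, Fin.sum_univ_two]
  push_cast
  ext <;> ring

lemma act_one (v : ZMod N × ZMod N) : act v 1 = v := by
  simp [act]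

lemma act_inj (γ : SL(2, ℤ)) : Function.Injective fun v : ZMod N × ZMod N => act v γ := by
  intro v w h
  have := congrArg (fun x => act x γ⁻¹) h
  simpa [← act_mul, act_one] using this

/-- bottom row -/
def brow (N : ℕ) (γ : SL(2, ℤ)) : ZMod N × ZMod N := ((γ 1 0 : ZMod N), (γ 1 1 : ZMod N))

lemma brow_eq (γ : SL(2, ℤ)) : brow N γ = act (0, 1) γ := by simp [brow, act]

/-- rows of determinant one matrices -/
def VV (N : ℕ) [NeZero N] : Finset (ZMod N × ZMod N) := by
  classical exact Finset.univ.filter fun v => ∃ γ : SL(2, ℤ), brow N γ = v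

lemma mem_VV {v : ZMod N × ZMod N} : v ∈ VV N ↔ ∃ γ : SL(2, ℤ), brow N γ = v := by
  classical
  simp [VV]

lemma act_mem {v : ZMod N × ZMod N} (hv : v ∈ VV N) (γ : SL(2, ℤ)) : act v γ ∈ VV N := by
  obtain ⟨δ, rfl⟩ := mem_VV.1 hv
  exact mem_VV.2 ⟨δ * γ, by rw [brow_eq, brow_eq, act_mul]⟩

lemma mem_of_coprime {C D : ℤ} (h : IsCoprime C D) : ((C : ZMod N), (D : ZMod N)) ∈ VV N := by
  obtain ⟨γ, h1, h2⟩ := h.exists_SL2_row 1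
  exact mem_VV.2 ⟨γ, by simp [brow, h1, h2]⟩

lemma scale_mem (l : (ZMod N)ˣ) {v : ZMod N × ZMod N} (hv : v ∈ VV N) : (v.1, (l : ZMod N) * v.2) ∈ VV N := by
  have key : ∃ C D : ℤ, C ≠ 0 ∧ IsCoprime C D ∧ ((C : ZMod N), (D : ZMod N)) = v := by
    obtain ⟨γ, rfl⟩ := mem_VV.1 hv
    have hc := Matrix.SpecialLinearGroup.isCoprime_row γ 1
    by_cases h0 : γ 1 0 = 0
    · refine ⟨N, γ 1 1, by exact_mod_cast NeZero.ne N, ?_, ?_⟩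
      · rw [h0, isCoprime_zero_left] at hc
        obtain ⟨u, hu⟩ := hc
        rw [← hu]
        exact isCoprime_one_right.of_isCoprime_of_dvd_right (u.isUnit.dvd)
      · simp [brow, h0]
    · exact ⟨_, _, h0, hc, rfl⟩
  obtain ⟨C, D, hC, hCD, rfl⟩ := key
  have hne : NeZero (N * C.natAbs) := ⟨by simp [hC, NeZero.ne N]⟩
  obtain ⟨l', hl'⟩ := ZMod.unitsMap_surjective (Dvd.intro C.natAbs rfl : N ∣ N * C.natAbs) l
  have h1 : ((l' : ZMod (N * C.natAbs)).val : ZMod N) = l := by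
    rw [← hl']
    simp [ZMod.unitsMap_def]
  have h2 : IsCoprime ((l' : ZMod (N * C.natAbs)).val : ℤ) C := by
    have := ZMod.val_coe_unit_coprime l'
    have := Nat.Coprime.coprime_mul_left_right this
    rw [Int.isCoprime_iff_gcd_eq_one, Int.gcd]
    rw [Int.natAbs_natCast]
    exact this
  have := mem_of_coprime (N := N) (IsCoprime.mul_right h2.symm hCD)
  simpa [h1, -ZMod.natCast_val] using this

lemma Hfun_slash (v : ZMod N × ZMod N) (γ : SL(2, ℤ)) (τ : ℍ) :
    Hfun v (γ • τ) = denom γ τ ^ (3 : ℤ) * Hfun (act v γ) τ := by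
  unfold Hfun
  rw [mul_left_comm]
  congr 1
  rw [← tsum_mul_left]
  have hbij : Function.Bijective (fun x : Fin 2 → ℤ => Matrix.vecMul x (γ : Matrix (Fin 2) (Fin 2) ℤ)) := by
    refine Function.bijective_iff_has_inverse.2 ⟨fun x => Matrix.vecMul x ((γ⁻¹ : SL(2, ℤ)) : Matrix (Fin 2) (Fin 2) ℤ), ?_, ?_⟩
    · intro x
      simp only [Matrix.vecMul_vecMul, ← Matrix.SpecialLinearGroup.coe_mul]
      simp
    · intro x
      simp only [Matrix.vecMul_vecMul, ← Matrix.SpecialLinearGroup.coe_mul]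
      simp
  rw [← (Equiv.ofBijective _ hbij).tsum_eq (fun x : Fin 2 → ℤ => denom γ τ ^ (3 : ℤ) * if ((x 0 : ZMod N), (x 1 : ZMod N)) = act v γ then
    EisensteinSeries.eisSummand 3 x τ else 0)]
  refine tsum_congr fun x => ?_
  rw [EisensteinSeries.eisSummand_SL2_apply]
  simp only [Equiv.ofBijective_apply, mul_ite, mul_zero]
  have : ((((Matrix.vecMul x (γ : Matrix (Fin 2) (Fin 2) ℤ)) 0 : ℤ) : ZMod N), (((Matrix.vecMul x (γ : Matrix (Fin 2) (Fin 2) ℤ)) 1 : ℤ) : ZMod N)) = act ((x 0 : ZMod N), (x 1 : ZMod N)) γ := by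
    simp [act, Matrix.vecMul, dotProduct, Fin.sum_univ_two]
  rw [this]
  congr 1
  exact propext ((act_inj γ).eq_iff).symm

lemma map_Hhat (σ : ℂ →+* ℂ) (l : ZMod N) (hl : ∀ b : ZMod N, σ (ee b) = ee (l * b))
    (v : ZMod N × ZMod N) : PowerSeries.map σ (Hhat v) = Hhat (v.1, l * v.2) := by
  unfold Hhat
  rw [map_add, PowerSeries.map_C]
  congr 2
  · simp only [apply_ite σ, map_zero]
    congr 1
    unfold Kc
    rw [map_mul, map_sum, map_div₀, map_pow, map_natCast, map_ofNat]
    congr 1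
    refine Finset.sum_congr rfl fun j _ => ?_
    rw [map_mul, hl, map_ratCast]
    congr 2
    ring
  · refine PowerSeries.ext fun n => ?_
    rw [PowerSeries.coeff_map, PowerSeries.coeff_mk, PowerSeries.coeff_mk, map_sum]
    refine Finset.sum_congr rfl fun p _ => ?_
    unfold cf
    rw [map_mul, map_sub, map_pow, map_natCast, apply_ite σ, apply_ite σ, hl, hl, map_zero]
    congr 4 <;> ring

lemma zmod_small (hN : 4 ≤ N) (a : ℕ) (ha : a ≠ 0) (h : a < 4) : (a : ZMod N) ≠ 0 := by
  rw [Ne, ZMod.natCast_eq_zero_iff]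
  intro hd
  have := Nat.le_of_dvd (Nat.pos_of_ne_zero ha) hd
  omega

lemma Hhat_inj0 (hN : 4 ≤ N) (v : ZMod N × ZMod N) (h : Hhat v = Hhat ((1, 0) : ZMod N × ZMod N)) : v = (1, 0) := by
  obtain ⟨a, b⟩ := v
  have n1 : (1 : ZMod N) ≠ 0 := by simpa using zmod_small hN 1 (by norm_num) (by norm_num)
  have n2 : (2 : ZMod N) ≠ 0 := by simpa using zmod_small hN 2 (by norm_num) (by norm_num)
  have n3 : (3 : ZMod N) ≠ 0 := by simpa using zmod_small hN 3 (by norm_num) (by norm_num)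
  have m1 : (1 : ZMod N) ≠ -1 := fun h => n2 (by linear_combination h)
  have m2 : (2 : ZMod N) ≠ 1 := fun h => n1 (by linear_combination h)
  have m3 : (2 : ZMod N) ≠ -1 := fun h => n3 (by linear_combination h)
  have e0 : ee (0 : ZMod N) = 1 := AddChar.map_zero_eq_one _
  have h1 := congrArg (PowerSeries.coeff 1) h
  have h2 := congrArg (PowerSeries.coeff 2) h
  have d2 : Nat.divisorsAntidiagonal 2 = {(1, 2), (2, 1)} := by decide
  simp only [Hhat, map_add, PowerSeries.coeff_mk, PowerSeries.coeff_C, Nat.divisorsAntidiagonal_one, d2,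
    Finset.sum_singleton, cf] at h1 h2
  rw [Finset.sum_pair (by decide), Finset.sum_pair (by decide)] at h2
  simp only [ee_mul_nat] at h1 h2
  simp [m1, m2, m3, e0] at h1 h2
  by_cases ha : 1 = a
  · subst ha
    simp [m1] at h1
    rw [← e0] at h1
    rw [ee_inj h1]
  · by_cases ha' : 1 = -a
    · have : a = -1 := by rw [ha', neg_neg]
      subst this
      simp [m1, m2, m3] at h1 h2
      rw [show ee (-b) = -1 by linear_combination -h1] at h2
      norm_num at h2
    · simp [ha, ha'] at h1

lemma Hhat_inj (hN : 4 ≤ N) {u v : ZMod N × ZMod N} (hu : u ∈ VV N) (h : Hhat v = Hhat u) : v = u := by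
  obtain ⟨γ, rfl⟩ := mem_VV.1 hu
  set δ : SL(2, ℤ) := γ⁻¹ * ModularGroup.S with hδ
  have h1 : act (brow N γ) δ = (1, 0) := by
    rw [brow_eq, ← act_mul, hδ, mul_inv_cancel_left]
    simp [act, ModularGroup.S]
  have hf : Hfun v = Hfun (brow N γ) := by
    funext τ
    have a1 := HE_Hfun v τ
    have a2 := HE_Hfun (brow N γ) τ
    rw [h] at a1
    exact a1.unique a2
  have hf2 : Hfun (act v δ) = Hfun ((1, 0) : ZMod N × ZMod N) := by
    funext τ
    have b1 := Hfun_slash v δ τ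
    have b2 := Hfun_slash (brow N γ) δ τ
    rw [hf, b2, h1] at b1
    exact (mul_left_cancel₀ (zpow_ne_zero _ (denom_ne_zero _ _)) b1).symm
  have h3 : Hhat (act v δ) = Hhat ((1, 0) : ZMod N × ZMod N) := by
    have a1 := HE_Hfun (act v δ)
    rw [hf2] at a1
    exact a1.unique (NeZero.pos N) (HE_Hfun _)
  have := Hhat_inj0 hN _ h3
  rw [← h1] at this
  exact act_inj δ this

end EisTwo

section Core

variable {N : ℕ} [NeZero N]

/-- Eisenstein series in the ring of good pairs -/
def xx (w : ZMod N × ZMod N) : Good N := ⟨(Hfun w, Hhat w), HE_Hfun w⟩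

/-- Lagrange polynomial -/
def LL (w : ZMod N × ZMod N) : Polynomial (Good N) :=
  ∏ u ∈ (VV N).erase w, (Polynomial.X - Polynomial.C (xx u))

/-- Lagrange denominators -/
def DD (w : ZMod N × ZMod N) : Good N := (LL w).eval (xx w)

lemma gF_xx (w : ZMod N × ZMod N) (τ : ℍ) : gF N (xx w) τ = Hfun w τ := rfl
lemma gS_xx (w : ZMod N × ZMod N) : gS N (xx w) = Hhat w := rfl

lemma LL_deg (w : ZMod N × ZMod N) : (LL w).natDegree < (VV N).card + 1 := by
  unfold LL
  refine Nat.lt_succ_of_le ((Polynomial.natDegree_prod_le _ _).trans ?_)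
  refine (Finset.sum_le_card_nsmul _ _ 1 fun u _ => Polynomial.natDegree_X_sub_C_le _).trans ?_
  simpa using Finset.card_erase_le

lemma gS_DD_ne (hN : 4 ≤ N) {w : ZMod N × ZMod N} (hw : w ∈ VV N) : gS N (DD w) ≠ 0 := by
  unfold DD LL
  rw [Polynomial.eval_prod, map_prod, Finset.prod_ne_zero_iff]
  intro u hu
  simp only [Polynomial.eval_sub, Polynomial.eval_X, Polynomial.eval_C, map_sub, gS_xx]
  rw [sub_ne_zero]
  intro h
  exact (Finset.mem_erase.1 hu).1 (Hhat_inj hN hw h.symm)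

lemma eval_LL_ne {w u : ZMod N × ZMod N} (hu : u ∈ VV N) (h : u ≠ w) : (LL w).eval (xx u) = 0 := by
  unfold LL
  rw [Polynomial.eval_prod]
  exact Finset.prod_eq_zero (Finset.mem_erase.2 ⟨h, hu⟩) (by simp)

/-- evaluation at a point -/
def ev (τ : ℍ) : Good N →+* ℂ := (Pi.evalRingHom (fun _ : ℍ => ℂ) τ).comp (gF N)

lemma sum_act (γ : SL(2, ℤ)) (g : ZMod N × ZMod N → ℂ) :
    ∑ v ∈ VV N, g (act v γ) = ∑ v ∈ VV N, g v := by
  refine Finset.sum_nbij' (fun v => act v γ) (fun v => act v γ⁻¹) ?_ ?_ ?_ ?_ ?_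
  · intro v hv; exact act_mem hv γ
  · intro v hv; exact act_mem hv γ⁻¹
  · intro v hv; simp [← act_mul, act_one]
  · intro v hv; simp [← act_mul, act_one]
  · intro v hv; rfl

lemma sum_scale (l : (ZMod N)ˣ) (g : ZMod N × ZMod N → PowerSeries ℂ) :
    ∑ v ∈ VV N, g v = ∑ v ∈ VV N, g (v.1, ((l⁻¹ : (ZMod N)ˣ) : ZMod N) * v.2) := by
  symm
  refine Finset.sum_nbij' (fun v => (v.1, ((l⁻¹ : (ZMod N)ˣ) : ZMod N) * v.2)) (fun v => (v.1, (l : ZMod N) * v.2))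
    ?_ ?_ ?_ ?_ ?_
  · intro v hv; exact scale_mem l⁻¹ hv
  · intro v hv; exact scale_mem l hv
  · intro v hv; exact Prod.ext rfl (Units.mul_inv_cancel_left l v.2)
  · intro v hv; exact Prod.ext rfl (Units.inv_mul_cancel_left l v.2)
  · intro v hv; rfl

lemma map_LL (w : ZMod N × ZMod N) (γ : SL(2, ℤ)) (τ : ℍ) :
    (LL w).map (ev (γ • τ)) = ∏ u ∈ (VV N).erase (act w γ),
      (Polynomial.X - Polynomial.C (denom γ τ ^ (3 : ℤ) * Hfun u τ)) := by
  unfold LL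
  rw [Polynomial.map_prod]
  refine Finset.prod_nbij' (fun v => act v γ) (fun v => act v γ⁻¹) ?_ ?_ ?_ ?_ ?_
  · intro v hv
    rw [Finset.mem_erase] at hv ⊢
    exact ⟨fun h => hv.1 (act_inj γ h), act_mem hv.2 γ⟩
  · intro v hv
    rw [Finset.mem_erase] at hv ⊢
    refine ⟨fun h => hv.1 ?_, act_mem hv.2 γ⁻¹⟩
    rw [← h, ← act_mul]; simp [act_one]
  · intro v hv; simp [← act_mul, act_one]
  · intro v hv; simp [← act_mul, act_one]
  · intro v hv
    rw [Polynomial.map_sub, Polynomial.map_X, Polynomial.map_C]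
    congr 2
    exact Hfun_slash v γ τ

lemma map_LL' (w : ZMod N × ZMod N) (τ : ℍ) :
    (LL w).map (ev τ) = ∏ u ∈ (VV N).erase w, (Polynomial.X - Polynomial.C (Hfun u τ)) := by
  have := map_LL w 1 τ
  simpa [act_one] using this

lemma LL_scale (w : ZMod N × ZMod N) (γ : SL(2, ℤ)) (τ : ℍ) :
    ((LL w).map (ev (γ • τ))).comp (Polynomial.C (denom γ τ ^ (3 : ℤ)) * Polynomial.X) =
      Polynomial.C ((denom γ τ ^ (3 : ℤ)) ^ ((VV N).erase (act w γ)).card) * (LL (act w γ)).map (ev τ) := by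
  rw [map_LL, map_LL', Polynomial.prod_comp, map_pow, ← Finset.prod_const, ← Finset.prod_mul_distrib]
  refine Finset.prod_congr rfl fun u _ => ?_
  simp [mul_sub]

lemma LL_coeff (w : ZMod N × ZMod N) (γ : SL(2, ℤ)) (τ : ℍ) (i : ℕ) :
    ev (γ • τ) ((LL w).coeff i) * (denom γ τ ^ (3 : ℤ)) ^ i =
      ((denom γ τ ^ (3 : ℤ)) ^ ((VV N).erase (act w γ)).card) * ev τ ((LL (act w γ)).coeff i) := by
  have := congrArg (fun p => Polynomial.coeff p i) (LL_scale w γ τ)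
  simpa only [Polynomial.comp_C_mul_X_coeff, Polynomial.coeff_C_mul, Polynomial.coeff_map] using this

lemma DD_scale (w : ZMod N × ZMod N) (γ : SL(2, ℤ)) (τ : ℍ) :
    ev (γ • τ) (DD w) = ((denom γ τ ^ (3 : ℤ)) ^ ((VV N).erase (act w γ)).card) * ev τ (DD (act w γ)) := by
  have := congrArg (fun p => Polynomial.eval (Hfun (act w γ) τ) p) (LL_scale w γ τ)
  simp only [Polynomial.eval_comp, Polynomial.eval_mul, Polynomial.eval_C, Polynomial.eval_X] at this
  unfold DD
  rw [← Polynomial.eval_map_apply, ← Polynomial.eval_map_apply]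
  rw [show ev (γ • τ) (xx w) = denom γ τ ^ (3 : ℤ) * Hfun (act w γ) τ from Hfun_slash w γ τ]
  exact this

lemma coreP (k : ℤ) (fam : ZMod N × ZMod N → ℍ → ℂ)
    (fh : ZMod N × ZMod N → PowerSeries ℂ) (hfam : ∀ v, HE N (fam v) (fh v))
    (hsl : ∀ v ∈ VV N, ∀ γ : SL(2, ℤ), fam v ∣[k] γ = fam (act v γ))
    (σ : ℂ →+* ℂ) (l : (ZMod N)ˣ) (hl : ∀ b : ZMod N, σ (ee b) = ee ((l : ZMod N) * b)) (i : ℕ) :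
    ∃ P : Good N, gS N P = ∑ w ∈ VV N, PowerSeries.map σ (fh (w.1, ((l⁻¹ : (ZMod N)ˣ) : ZMod N) * w.2)) * Hhat w ^ i ∧
      ∀ γ : SL(2, ℤ), ∀ τ, gF N P (γ • τ) = denom γ τ ^ k * (denom γ τ ^ (3 : ℤ)) ^ i * gF N P τ := by
  have hN : 0 < N := NeZero.pos N
  have hfam' : ∀ v ∈ VV N, ∀ γ : SL(2, ℤ), ∀ τ, fam v (γ • τ) = denom γ τ ^ k * fam (act v γ) τ := by
    intro v hv γ τ
    rw [← hsl v hv γ, ModularForm.SL_slash_apply, mul_comm, mul_assoc, ← zpow_add₀ (denom_ne_zero _ _)]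
    simp
  let ff : ZMod N × ZMod N → Good N := fun v => ⟨(fam v, fh v), hfam v⟩
  obtain ⟨p, hpd⟩ : ∃ p : Good N, p = ∑ v ∈ VV N, ff v * xx v ^ i := ⟨_, rfl⟩
  have hp : ∀ τ, gF N p τ = ∑ v ∈ VV N, fam v τ * Hfun v τ ^ i := by
    intro τ
    simp only [hpd, map_sum, map_mul, map_pow, Finset.sum_apply, Pi.mul_apply, Pi.pow_apply]
    rfl
  have hps : gS N p = ∑ v ∈ VV N, fh v * Hhat v ^ i := by
    simp only [hpd, map_sum, map_mul, map_pow]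
    rfl
  have hpinv : ∀ γ : SL(2, ℤ), gF N p ∣[(k + 3 * i : ℤ)] γ = gF N p := by
    intro γ
    funext τ
    rw [ModularForm.SL_slash_apply, hp, hp, ← sum_act γ (fun v => fam v τ * Hfun v τ ^ i), Finset.sum_mul]
    refine Finset.sum_congr rfl fun v hv => ?_
    rw [hfam' v hv, Hfun_slash]
    have hj := denom_ne_zero γ τ
    generalize denom γ τ = j at hj ⊢
    rw [neg_add, zpow_add₀ hj, zpow_neg, zpow_neg, zpow_mul, zpow_natCast]
    have h1 := zpow_ne_zero k hj
    have h2 := pow_ne_zero i (zpow_ne_zero 3 hj)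
    rw [mul_pow]
    field_simp
  have hl2 : ∀ v : ZMod N × ZMod N, PowerSeries.map σ (Hhat (v.1, ((l⁻¹ : (ZMod N)ˣ) : ZMod N) * v.2)) = Hhat v := by
    intro v
    have h1 := map_Hhat (N := N) σ (l : ZMod N) hl (v.1, ((l⁻¹ : (ZMod N)ˣ) : ZMod N) * v.2)
    have h2 : (v.1, (l : ZMod N) * (((l⁻¹ : (ZMod N)ˣ) : ZMod N) * v.2)) = v :=
      Prod.ext rfl (Units.mul_inv_cancel_left l v.2)
    rw [h2] at h1
    exact h1
  clear_value ff
  clear hl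
  obtain ⟨G, hG, hG2⟩ := exists_conj σ hN (gHE p) hpinv
  refine ⟨⟨(G, _), hG⟩, ?_, ?_⟩
  · change PowerSeries.map σ (gS N p) = _
    rw [hps, map_sum, sum_scale l]
    refine Finset.sum_congr rfl fun v hv => ?_
    rw [map_mul, map_pow, hl2 v]
  · intro γ τ
    change G (γ • τ) = denom γ τ ^ k * (denom γ τ ^ (3 : ℤ)) ^ i * G τ
    conv_rhs => rw [← hG2 γ]
    have hj := denom_ne_zero γ τ
    rw [ModularForm.SL_slash_apply]
    generalize denom γ τ = j at hj ⊢
    rw [neg_add, zpow_add₀ hj, zpow_neg, zpow_neg, zpow_mul, zpow_natCast]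
    have h1 := zpow_ne_zero k hj
    have h2 := pow_ne_zero i (zpow_ne_zero 3 hj)
    field_simp

lemma core (k : ℤ) (fam : ZMod N × ZMod N → ℍ → ℂ)
    (fh : ZMod N × ZMod N → PowerSeries ℂ) (hfam : ∀ v, HE N (fam v) (fh v))
    (hsl : ∀ v ∈ VV N, ∀ γ : SL(2, ℤ), fam v ∣[k] γ = fam (act v γ))
    (σ : ℂ →+* ℂ) (l : (ZMod N)ˣ) (hl : ∀ b : ZMod N, σ (ee b) = ee ((l : ZMod N) * b))
    (F : ℍ → ℂ) (hF : HE N F (PowerSeries.map σ (fh (0, 1)))) (γ : SL(2, ℤ)) :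
    ∃ W : Good N, (∀ τ, gF N (DD (act (0, (l : ZMod N)) γ)) τ * (F ∣[k] γ) τ = gF N W τ) ∧
      gS N W = gS N (DD (act (0, (l : ZMod N)) γ)) *
        PowerSeries.map σ (fh ((l : ZMod N) * (γ 1 0 : ZMod N), (γ 1 1 : ZMod N))) := by
  choose P hPS2 hPF using coreP k fam fh hfam hsl σ l hl
  obtain ⟨Y, hY⟩ : ∃ Y : ZMod N × ZMod N → PowerSeries ℂ, ∀ w, Y w = PowerSeries.map σ (fh (w.1, ((l⁻¹ : (ZMod N)ˣ) : ZMod N) * w.2)) := ⟨_, fun _ => rfl⟩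
  simp only [← hY] at hPS2
  let W : ZMod N × ZMod N → Good N := fun w => ∑ i ∈ Finset.range ((VV N).card + 1), (LL w).coeff i * P i
  have hWS : ∀ w ∈ VV N, gS N (W w) = gS N (DD w) * Y w := by
    intro w hw
    have h1 : gS N (W w) = ∑ u ∈ VV N, Y u * gS N ((LL w).eval (xx u)) := by
      simp only [W, map_sum, map_mul, hPS2, Finset.mul_sum]
      rw [Finset.sum_comm]
      refine Finset.sum_congr rfl fun u _ => ?_
      rw [Polynomial.eval_eq_sum_range' (LL_deg w), map_sum, Finset.mul_sum]
      refine Finset.sum_congr rfl fun i _ => ?_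
      rw [map_mul, map_pow, gS_xx]
      ring
    rw [h1, Finset.sum_eq_single w]
    · rw [mul_comm]; rfl
    · intro u hu hne
      rw [eval_LL_ne hu hne, map_zero, mul_zero]
    · intro h; exact absurd hw h
  have hw0 : ((0, (l : ZMod N)) : ZMod N × ZMod N) ∈ VV N := by
    have h01 : ((0, 1) : ZMod N × ZMod N) ∈ VV N := mem_VV.2 ⟨1, by simp [brow]⟩
    have := scale_mem l h01
    simpa using this
  set w0 : ZMod N × ZMod N := (0, (l : ZMod N)) with hw0d
  have hY0 : Y w0 = PowerSeries.map σ (fh (0, 1)) := by simp [hY, hw0d]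
  let φ : Good N := ⟨(F, PowerSeries.map σ (fh (0, 1))), hF⟩
  have hφ : DD w0 * φ = W w0 := by
    apply gS_inj N
    rw [map_mul, hWS w0 hw0, hY0]
    rfl
  refine ⟨W (act w0 γ), fun τ => ?_, ?_⟩
  · have h1 := congrArg (ev (γ • τ)) hφ
    have hj := denom_ne_zero γ τ
    rw [map_mul, DD_scale] at h1
    have h2 : ev (γ • τ) (W w0) = denom γ τ ^ k * (((denom γ τ ^ (3 : ℤ)) ^ ((VV N).erase (act w0 γ)).card) * ev τ (W (act w0 γ))) := by
      simp only [W, map_sum, map_mul, Finset.mul_sum]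
      refine Finset.sum_congr rfl fun i _ => ?_
      have h3 : ev (γ • τ) (P i) = denom γ τ ^ k * (denom γ τ ^ (3 : ℤ)) ^ i * ev τ (P i) := by
        exact hPF i γ τ
      rw [h3]
      have h4 := LL_coeff w0 γ τ i
      rw [← mul_assoc (_ ^ _) (ev τ ((LL (act w0 γ)).coeff i)), ← h4]
      ring
    rw [h2] at h1
    have h5 : ev τ (DD (act w0 γ)) * F (γ • τ) = denom γ τ ^ k * ev τ (W (act w0 γ)) := by
      have ht : ((denom γ τ ^ (3 : ℤ)) ^ ((VV N).erase (act w0 γ)).card) ≠ 0 := pow_ne_zero _ (zpow_ne_zero _ hj)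
      refine mul_left_cancel₀ ht ?_
      rw [← mul_assoc, mul_left_comm]
      exact h1
    rw [ModularForm.SL_slash_apply, ← mul_assoc]
    change ev τ (DD (act w0 γ)) * F (γ • τ) * _ = ev τ (W (act w0 γ))
    rw [h5, zpow_neg]
    have := zpow_ne_zero k hj
    field_simp
  · rw [hWS _ (act_mem hw0 γ)]
    congr 1
    simp [hY, act, hw0d]

lemma HE.shift {F : ℍ → ℂ} {c : PowerSeries ℂ} (h : HE N F c) (hz : ∀ τ : ℍ, 1 ≤ τ.im → F τ = 0) : c = 0 := by
  have hN : 0 < N := NeZero.pos N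
  set r : ℂ := Complex.exp (2 * π * Complex.I * Complex.I / N) with hr
  have h1 : HE N (fun _ => 0) (PowerSeries.mk fun m => PowerSeries.coeff m c * r ^ m) := by
    intro τ
    have him : 0 < ((τ : ℂ) + Complex.I).im := by
      have := τ.im_pos
      simp; linarith [τ.coe_im]
    have h2 := h ⟨(τ : ℂ) + Complex.I, him⟩
    rw [hz] at h2
    · convert! h2 using 1
      funext m
      rw [PowerSeries.coeff_mk, mul_assoc, ← mul_pow]
      congr 2
      rw [qP_ne, qP_ne, hr, ← Complex.exp_add]
      congr 1
      change _ = 2 * π * Complex.I * ((τ : ℂ) + Complex.I) / N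
      ring
    · change 1 ≤ ((τ : ℂ) + Complex.I).im
      have := τ.im_pos
      simp
      linarith [τ.coe_im]
  have h2 := h1.unique hN (HE.const N 0)
  refine PowerSeries.ext fun m => ?_
  have h3 := congrArg (PowerSeries.coeff m) h2
  rw [PowerSeries.coeff_mk, map_zero, map_zero] at h3
  have : r ^ m ≠ 0 := pow_ne_zero _ (Complex.exp_ne_zero _)
  simpa [this] using h3

end Core

theorem ext_hom {R S M : Type*} [CommRing R] [IsDomain R] [Field S] [Field M] [IsAlgClosed M]
    [Algebra R S] (hinj : Function.Injective (algebraMap R S)) [Algebra.IsAlgebraic R S] (φ : R →+* M)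
    (hφ : Function.Injective φ) : ∃ σ : S →+* M, ∀ r, σ (algebraMap R S r) = φ r := by
  letI := φ.toAlgebra
  haveI : FaithfulSMul R S := (faithfulSMul_iff_algebraMap_injective R S).2 hinj
  haveI : FaithfulSMul R M := (faithfulSMul_iff_algebraMap_injective R M).2 hφ
  let s : S →ₐ[R] M := IsAlgClosed.lift
  exact ⟨s.toRingHom, fun r => s.commutes r⟩

theorem aut_alg {F : Type} [Field F] [Algebra F ℂ] (x : ℂ) (hx : IsAlgebraic F x)
    (hx' : x ∉ Set.range (algebraMap F ℂ)) :
    ∃ σ : ℂ →+* ℂ, (∀ y : F, σ (algebraMap F ℂ y) = algebraMap F ℂ y) ∧ σ x ≠ x := by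
  haveI : CharZero F := (algebraMap F ℂ).charZero_iff (algebraMap F ℂ).injective |>.2 inferInstance
  let L := algebraicClosure F ℂ
  haveI : IsAlgClosure F L := inferInstance
  haveI : Normal F L := IsAlgClosure.normal F L
  haveI : IsGalois F L := ⟨⟩
  let x' : L := ⟨x, mem_algebraicClosure_iff.2 hx⟩
  have h1 : ∃ s : L ≃ₐ[F] L, s x' ≠ x' := by
    by_contra! h
    have h2 := (InfiniteGalois.mem_bot_iff_fixed x').2 h
    obtain ⟨y, hy⟩ := IntermediateField.mem_bot.1 h2
    exact hx' ⟨y, congrArg (fun t : L => (t : ℂ)) hy⟩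
  obtain ⟨s, hs⟩ := h1
  obtain ⟨B, hB⟩ := exists_isTranscendenceBasis L ℂ
  haveI := hB.isAlgebraic
  let e := hB.1.aevalEquiv
  let R := Algebra.adjoin L (Set.range (Subtype.val : B → ℂ))
  let φ : R →+* ℂ := ((MvPolynomial.aeval (R := L) (Subtype.val : B → ℂ)).toRingHom.comp
    (MvPolynomial.map s.toRingEquiv.toRingHom)).comp e.symm.toRingEquiv.toRingHom
  have hφ : Function.Injective φ := by
    apply Function.Injective.comp (g := (MvPolynomial.aeval (R := L) (Subtype.val : B → ℂ)).toRingHom.comp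
      (MvPolynomial.map s.toRingEquiv.toRingHom))
    · apply Function.Injective.comp (g := MvPolynomial.aeval (R := L) (Subtype.val : B → ℂ))
      · exact hB.1
      · exact MvPolynomial.map_injective _ s.injective
    · exact e.symm.injective
  obtain ⟨σ, hσ⟩ := ext_hom (R := R) (S := ℂ) (M := ℂ) Subtype.val_injective φ hφ
  have key : ∀ y : L, σ (y : ℂ) = (s y : ℂ) := by
    intro y
    have := hσ (algebraMap L R y)
    have h2 : e.symm (algebraMap L R y) = MvPolynomial.C y := e.symm.commutes y
    have h3 : φ (algebraMap L R y) = (s y : ℂ) := by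
      change (MvPolynomial.aeval (R := L) (Subtype.val : B → ℂ)) (MvPolynomial.map s.toRingEquiv.toRingHom (e.symm (algebraMap L R y))) = _
      rw [h2, MvPolynomial.map_C, MvPolynomial.aeval_C]
      rfl
    rw [h3] at this
    exact this
  refine ⟨σ, fun y => ?_, fun h => hs (Subtype.ext ?_)⟩
  · have := key (algebraMap F L y)
    rw [s.commutes] at this
    exact this
  · rw [← key]; exact h

theorem exists_aut (K : Subfield ℂ) (x : ℂ) (hx : x ∉ K) :
    ∃ σ : ℂ →+* ℂ, (∀ y ∈ K, σ y = y) ∧ σ x ≠ x := by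
  by_cases ha : IsAlgebraic K x
  · obtain ⟨σ, h1, h2⟩ := aut_alg (F := K) x ha (by rintro ⟨y, rfl⟩; exact hx y.2)
    exact ⟨σ, fun y hy => h1 ⟨y, hy⟩, h2⟩
  · let F := IntermediateField.adjoin K {x ^ 2}
    have hm : x ^ 2 ∈ F := IntermediateField.mem_adjoin_simple_self K _
    have hxF : x ∉ F := by
      intro h
      apply ha
      refine Field.isAlgebraic_of_adjoin_eq_adjoin K ℂ (m := 1) (n := 2) (by norm_num) ?_
      rw [pow_one]
      apply le_antisymm
      · rw [IntermediateField.adjoin_simple_le_iff]; exact h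
      · rw [IntermediateField.adjoin_simple_le_iff]
        exact pow_mem (IntermediateField.mem_adjoin_simple_self K x) 2
    have halg : IsAlgebraic F x := by
      refine IsAlgebraic.of_pow (n := 2) (by norm_num) ?_
      exact isAlgebraic_algebraMap (⟨x ^ 2, hm⟩ : F)
    obtain ⟨σ, h1, h2⟩ := aut_alg (F := F) x halg (by rintro ⟨y, hy⟩; exact hxF (hy ▸ y.2))
    exact ⟨σ, fun y hy => h1 ⟨y, F.algebraMap_mem ⟨y, hy⟩⟩, h2⟩

lemma slash_congr {N : ℕ} {k : ℤ} (f : ModularForm (Gamma1 N) k) (γ δ : SL(2, ℤ))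
    (h : brow N γ = brow N δ) : (⇑f ∣[k] γ) = ⇑f ∣[k] δ := by
  have hm : γ * δ⁻¹ ∈ Gamma1 N := by
    rw [Gamma1_mem]
    simp only [brow, Prod.mk.injEq] at h
    obtain ⟨h1, h2⟩ := h
    have d1 := Matrix.SpecialLinearGroup.det_coe γ
    have d2 := Matrix.SpecialLinearGroup.det_coe δ
    rw [Matrix.det_fin_two] at d1 d2
    have d1' := congrArg (fun t : ℤ => (t : ZMod N)) d1
    have d2' := congrArg (fun t : ℤ => (t : ZMod N)) d2
    push_cast at d1' d2'
    simp only [Matrix.SpecialLinearGroup.coe_mul, Matrix.SpecialLinearGroup.coe_inv,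
      Matrix.adjugate_fin_two, Matrix.mul_apply, Fin.sum_univ_two]
    simp
    rw [h1, h2] at *
    refine ⟨?_, ?_, ?_⟩
    · linear_combination d1'
    · linear_combination d2'
    · ring
  have h1 : (⇑f ∣[k] (γ * δ⁻¹)) = ⇑f := by
    rw [ModularForm.SL_slash]
    exact SlashInvariantFormClass.slash_action_eq f _ ⟨_, hm, rfl⟩
  calc (⇑f ∣[k] γ) = ⇑f ∣[k] ((γ * δ⁻¹) * δ) := by simp
    _ = ⇑f ∣[k] δ := by rw [SlashAction.slash_mul, h1]

lemma slash_HE {N : ℕ} [NeZero N] {k : ℤ} (f : ModularForm (Gamma1 N) k) (γ : SL(2, ℤ)) (N' : ℕ) (hN' : 0 < N')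
    (hd : N ∣ N') : HE N' (⇑f ∣[k] γ) (qExpansion (N' : ℝ) (⇑f ∣[k] γ)) := by
  intro τ
  have hper : (⇑f ∣[k] γ) ∣[k] (ModularGroup.T ^ (N' : ℤ)) = ⇑f ∣[k] γ := by
    rw [← SlashAction.slash_mul]
    apply slash_congr
    have : (N' : ZMod N) = 0 := (ZMod.natCast_eq_zero_iff _ _).2 hd
    simp only [brow, Matrix.SpecialLinearGroup.coe_mul, Matrix.mul_apply, Fin.sum_univ_two,
      ModularGroup.coe_T_zpow]
    simp [this]
  have hp : ∀ τ : ℍ, (⇑f ∣[k] γ) ((N' : ℝ) +ᵥ τ) = (⇑f ∣[k] γ) τ := by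
    intro τ
    conv_rhs => rw [← hper]
    rw [ModularForm.SL_slash_apply (f := ⇑f ∣[k] γ)]
    have h1 : ModularGroup.T ^ (N' : ℤ) • τ = (N' : ℝ) +ᵥ τ := by
      have := UpperHalfPlane.modular_T_zpow_smul τ N'
      simpa using this
    have h2 : denom ((ModularGroup.T ^ (N' : ℤ) : SL(2, ℤ)) : GL (Fin 2) ℝ) τ = 1 := by
      rw [ModularGroup.denom_apply, ModularGroup.coe_T_zpow]; simp
    rw [h1, h2]; simp
  have := UpperHalfPlane.hasSum_qExpansion (h := (N' : ℝ)) (f := ⇑f ∣[k] γ) (by exact_mod_cast hN') ?_ ?_ ?_ τ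
  · simpa using this
  · intro z
    simp only [Function.comp]
    by_cases hz : 0 < z.im
    · have hz' : 0 < (z + (N' : ℝ)).im := by simpa using hz
      rw [ofComplex_apply_of_im_pos hz, ofComplex_apply_of_im_pos hz', ← hp ⟨z, hz⟩]
      refine congrArg _ (UpperHalfPlane.ext ?_)
      simp [add_comm]
    · have hz' : ¬ 0 < (z + (N' : ℝ)).im := by simpa using hz
      rw [ofComplex_apply_of_im_nonpos (not_lt.1 hz), ofComplex_apply_of_im_nonpos (not_lt.1 hz')]
  · rw [ModularForm.SL_slash]
    exact MDifferentiable.slash (ModularFormClass.holo f) _ _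
  · exact ModularFormClass.bdd_at_infty_slash f γ

lemma sigma_unit (N : ℕ) [NeZero N] (σ : ℂ →+* ℂ) :
    ∃ l : (ZMod N)ˣ, ∀ b : ZMod N, σ (ee b) = ee ((l : ZMod N) * b) := by
  have hnN : ∀ b : ZMod N, ee b = ee (1 : ZMod N) ^ b.val := by
    intro b
    rw [← ee_mul_nat, one_mul, ZMod.natCast_zmod_val]
  have hprim : IsPrimitiveRoot (ee (1 : ZMod N)) N := by
    have := Complex.isPrimitiveRoot_exp N (NeZero.ne N)
    have h1 := ee_int (N := N) 1
    push_cast at h1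
    rw [h1]
    simpa using this
  have h2 := hprim.map_of_injective σ.injective
  rw [hprim.isPrimitiveRoot_iff] at h2
  obtain ⟨i, _, hi, he⟩ := h2
  refine ⟨ZMod.unitOfCoprime i hi, fun b => ?_⟩
  rw [ZMod.coe_unitOfCoprime, mul_comm, ee_mul_nat, hnN b, map_pow, ← he, ← pow_mul, ← pow_mul, mul_comm]

lemma brow_cast {N N' : ℕ} (hd : N ∣ N') {γ δ : SL(2, ℤ)} (h : brow N' γ = brow N' δ) :
    brow N γ = brow N δ := by
  have := congrArg (fun v : ZMod N' × ZMod N' => (ZMod.castHom hd (ZMod N) v.1, ZMod.castHom hd (ZMod N) v.2)) h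
  simpa [brow] using this

open Classical in
/-- a chosen matrix with given bottom row -/
def gof (N' : ℕ) (v : ZMod N' × ZMod N') : SL(2, ℤ) :=
  if h : ∃ γ : SL(2, ℤ), brow N' γ = v then h.choose else 1

lemma brow_gof {N' : ℕ} [NeZero N'] {v : ZMod N' × ZMod N'} (hv : v ∈ VV N') : brow N' (gof N' v) = v := by
  have h := mem_VV.1 hv
  rw [gof, dif_pos h]
  exact h.choose_spec

lemma fam_slash {N N' : ℕ} [NeZero N'] (hd : N ∣ N') {k : ℤ} (f : ModularForm (Gamma1 N) k)
    (v : ZMod N' × ZMod N') (hv : v ∈ VV N') (γ : SL(2, ℤ)) :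
    (⇑f ∣[k] gof N' v) ∣[k] γ = ⇑f ∣[k] gof N' (act v γ) := by
  rw [← SlashAction.slash_mul]
  apply slash_congr
  apply brow_cast hd
  rw [brow_gof (act_mem hv γ), brow_eq, act_mul, ← brow_eq, brow_gof hv]

lemma mem01 (N' : ℕ) [NeZero N'] : ((0, 1) : ZMod N' × ZMod N') ∈ VV N' :=
  mem_VV.2 ⟨1, by simp [brow]⟩

lemma fam_01 {N N' : ℕ} [NeZero N'] (hd : N ∣ N') {k : ℤ} (f : ModularForm (Gamma1 N) k) :
    (⇑f ∣[k] gof N' (0, 1)) = ⇑f := by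
  have : (⇑f ∣[k] gof N' (0, 1)) = ⇑f ∣[k] (1 : SL(2, ℤ)) := by
    apply slash_congr
    apply brow_cast hd
    rw [brow_gof (mem01 N')]
    simp [brow]
  rw [this, SlashAction.slash_one]

lemma mem_lCD {N' : ℕ} [NeZero N'] (l : (ZMod N')ˣ) (g : SL(2, ℤ)) :
    ((l : ZMod N') * (g 1 0 : ZMod N'), (g 1 1 : ZMod N')) ∈ VV N' := by
  have h1 := scale_mem l (mem01 N')
  have h2 := act_mem h1 g
  have h3 := scale_mem l⁻¹ h2
  simpa [act] using h3

lemma sigma_f {N N' : ℕ} [NeZero N] [NeZero N'] (h4 : 4 ≤ N') (hd : N ∣ N') {k : ℤ} (hk : 1 ≤ k)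
    (f : ModularForm (Gamma1 N) k) (a : ℕ → ℂ) (ha : HasExpansion 1 (⇑f) a)
    (σ : ℂ →+* ℂ) (hσ : ∀ m, 1 ≤ m → σ (a m) = a m) (l : (ZMod N')ˣ)
    (hl : ∀ b : ZMod N', σ (ee b) = ee ((l : ZMod N') * b)) :
    HE N' (⇑f) (PowerSeries.map σ (qExpansion (N' : ℝ) (⇑f ∣[k] gof N' (0, 1)))) := by
  have hN' : 0 < N' := NeZero.pos N'
  have hA : HE N' (⇑f) (PowerSeries.expand N' (NeZero.ne N') (PowerSeries.mk a)) := by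
    have := ((HE_iff _ _ _).1 ha).expand one_pos (NeZero.ne N')
    rwa [mul_one] at this
  set fh : ZMod N' × ZMod N' → PowerSeries ℂ := fun v => qExpansion (N' : ℝ) (⇑f ∣[k] gof N' v) with hfh
  have hfam : ∀ v : ZMod N' × ZMod N', HE N' (⇑f ∣[k] gof N' v) (fh v) :=
    fun v => slash_HE f _ N' hN' hd
  have hA' : fh (0, 1) = PowerSeries.expand N' (NeZero.ne N') (PowerSeries.mk a) := by
    have h1 := hfam (0, 1)
    rw [fam_01 hd f] at h1
    exact h1.unique hN' hA
  have hmap : PowerSeries.map σ (fh (0, 1)) = fh (0, 1) + PowerSeries.C (σ (a 0) - a 0) := by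
    rw [hA', PowerSeries.map_expand]
    have : PowerSeries.map σ (PowerSeries.mk a) = PowerSeries.mk a + PowerSeries.C (σ (a 0) - a 0) := by
      ext m
      rcases Nat.eq_zero_or_pos m with rfl | hm
      · simp
      · simp [PowerSeries.coeff_C, hm.ne', hσ m hm]
    rw [this, map_add, PowerSeries.expand_C]
  set δ := σ (a 0) - a 0 with hδ
  change HE N' (⇑f) (PowerSeries.map σ (fh (0, 1)))
  suffices h0 : δ = 0 by
    rw [hmap, h0, map_zero, add_zero, hA']; exact hA
  by_contra hne
  have hF : HE N' (⇑f + fun _ => δ) (PowerSeries.map σ (fh (0, 1))) := by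
    rw [hmap, hA']
    exact hA.add (HE.const N' δ)
  let γ : SL(2, ℤ) := ⟨!![1, 0; (N' : ℤ), 1], by simp [Matrix.det_fin_two]⟩
  have g00 : γ 0 0 = 1 := rfl
  have g01 : γ 0 1 = 0 := rfl
  have g10 : γ 1 0 = (N' : ℤ) := rfl
  have g11 : γ 1 1 = 1 := rfl
  obtain ⟨W1, h1, h1'⟩ := core k _ fh hfam (fam_slash hd f) σ l hl _ hF γ
  obtain ⟨W2, h2, h2'⟩ := core k _ fh hfam (fam_slash hd f) σ l hl _ hF 1
  have e1 : act (0, (l : ZMod N')) γ = (0, (l : ZMod N')) := by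
    simp [act, g10, g11]
  have e2 : ((l : ZMod N') * (γ 1 0 : ZMod N'), (γ 1 1 : ZMod N')) = (0, 1) := by
    simp [g10, g11]
  have e3 : ((l : ZMod N') * (((1 : SL(2, ℤ)) 1 0 : ℤ) : ZMod N'), (((1 : SL(2, ℤ)) 1 1 : ℤ) : ZMod N')) = (0, 1) := by
    simp
  rw [e1, e2] at h1'
  rw [act_one, e3] at h2'
  rw [e1] at h1
  rw [act_one, SlashAction.slash_one] at h2
  have hW : W1 = W2 := gS_inj N' (h1'.trans h2'.symm)
  have hfγ : (⇑f ∣[k] γ) = ⇑f := by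
    have : (⇑f ∣[k] γ) = ⇑f ∣[k] (1 : SL(2, ℤ)) := by
      apply slash_congr
      apply brow_cast hd
      simp [brow, g10, g11]
    rw [this, SlashAction.slash_one]
  have hmem : ((0 : ZMod N'), (l : ZMod N')) ∈ VV N' := by
    simpa using scale_mem l (mem01 N')
  apply gS_DD_ne h4 hmem
  refine (gHE (DD ((0 : ZMod N'), (l : ZMod N')))).shift fun τ hτ => ?_
  have h3 := (h1 τ).trans ((congrArg (fun w => gF N' w τ) hW).trans (h2 τ).symm)
  rw [ModularForm.SL_slash_apply] at h3
  have h4' := congrFun hfγ τ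
  rw [ModularForm.SL_slash_apply] at h4'
  simp only [Pi.add_apply, add_mul, h4'] at h3
  have hj : ‖denom (γ : GL (Fin 2) ℝ) τ‖ > 1 := by
    have : denom (γ : GL (Fin 2) ℝ) τ = N' * (τ : ℂ) + 1 := by
      rw [ModularGroup.denom_apply, g10, g11]; simp
    rw [this]
    have him : (N' * (τ : ℂ) + 1).im = N' * τ.im := by simp
    have := Complex.abs_im_le_norm (N' * (τ : ℂ) + 1)
    rw [him] at this
    have h5 : (4 : ℝ) ≤ N' := by exact_mod_cast h4
    have h6 := le_abs_self ((N' : ℝ) * τ.im)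
    nlinarith
  have hj' : denom (γ : GL (Fin 2) ℝ) τ ^ (-k) ≠ 1 := by
    intro h
    have h5 := congrArg norm h
    rw [norm_zpow, norm_one] at h5
    have := zpow_lt_one_of_neg₀ hj (show -k < 0 by omega)
    exact this.ne h5
  have h7 : gF N' (DD (0, (l : ZMod N'))) τ * (δ * (denom (γ : GL (Fin 2) ℝ) τ ^ (-k) - 1)) = 0 := by
    linear_combination h3
  rcases mul_eq_zero.1 h7 with h | h
  · exact h
  · exact absurd h (mul_ne_zero hne (sub_ne_zero.2 hj'))

lemma lam_cond {N : ℕ} [NeZero N] (σ : ℂ →+* ℂ) (C : ℤ) (M : ℕ) (hM : M = N / Int.gcd C N)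
    (hz : σ (zetaC M) = zetaC M) (N' : ℕ) [NeZero N'] (h' : N' = 4 * N) (l : (ZMod N')ˣ)
    (hl : ∀ b : ZMod N', σ (ee b) = ee ((l : ZMod N') * b)) (x : ℤ)
    (hx : (x : ZMod N') = (l : ZMod N') * (C : ZMod N')) : (x : ZMod N) = (C : ZMod N) := by
  set d := Int.gcd C N with hdd
  have hN0 : N ≠ 0 := NeZero.ne N
  have hdN : d ∣ N := by
    have := Int.gcd_dvd_right C (N : ℤ); exact_mod_cast this
  have hdC : (d : ℤ) ∣ C := Int.gcd_dvd_left C (N : ℤ)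
  have hMd : M * d = N := by rw [hM]; exact Nat.div_mul_cancel hdN
  have hM0 : M ≠ 0 := by rintro rfl; simp at hMd; exact hN0 hMd.symm
  have hd0 : d ≠ 0 := by intro h; rw [h] at hMd; simp at hMd; exact hN0 hMd.symm
  have hzeta : zetaC M = ee (N := N') ((4 * d : ℤ) : ZMod N') := by
    rw [ee_int, zetaC, h', ← hMd]
    congr 1
    have h1 : (M : ℂ) ≠ 0 := by exact_mod_cast hM0
    have h2 : (d : ℂ) ≠ 0 := by exact_mod_cast hd0
    push_cast
    field_simp
  rw [hzeta, hl] at hz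
  have h1 := ee_inj hz
  set lam : ℤ := ((l : ZMod N').val : ℤ) with hlam
  have hlc : (l : ZMod N') = (lam : ZMod N') := by
    rw [hlam, Int.cast_natCast, ZMod.natCast_zmod_val]
  rw [hlc] at h1 hx
  have h2 : ((lam * (4 * d) : ℤ) : ZMod N') = ((4 * d : ℤ) : ZMod N') := by
    rw [Int.cast_mul]; exact h1
  have h3 : (x : ZMod N') = ((lam * C : ℤ) : ZMod N') := by rw [Int.cast_mul]; exact hx
  rw [ZMod.intCast_eq_intCast_iff_dvd_sub] at h2 h3 ⊢
  subst h'
  push_cast at h2 h3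
  obtain ⟨e, he⟩ := hdC
  obtain ⟨u, hu⟩ := h2
  obtain ⟨v, hv⟩ := h3
  refine ⟨u * e + 4 * v, ?_⟩
  have hu' : (d : ℤ) - lam * d = N * u := by linarith
  have : C - lam * C = N * u * e := by
    rw [he]; linear_combination e * hu'
  linear_combination this + hv

/-- Let `f` be a modular form of weight `k ≥ 1` on `Γ₁(N)` and let
`g = (A,B;C,D) ∈ SL₂(ℤ)`. Set `M = N/gcd(C,N)`. Then every Fourier coefficient of `f|_k g`
(in its expansion `Σ_{n≥0} c_n e^{2πinτ/N}`) lies in the subfield `K_f(ζ_M)` of `ℂ`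
generated by the Fourier coefficients `a_n(f)`, `n ≥ 1`, together with `ζ_M`. -/
theorem stmt_5 (N : ℕ) (hN : 1 ≤ N) (k : ℤ) (hk : 1 ≤ k)
    (f : ModularForm (Gamma1 N) k)
    (a : ℕ → ℂ) (ha : HasExpansion 1 (⇑f) a)
    (g : SL(2, ℤ)) (M : ℕ) (hM : M = N / Int.gcd (g 1 0) N)
    (c : ℕ → ℂ) (hc : HasExpansion N (⇑f ∣[k] g) c) :
    ∀ n : ℕ, c n ∈ Subfield.closure ({x : ℂ | ∃ m : ℕ, 1 ≤ m ∧ x = a m} ∪ {zetaC M}) := by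
  intro n
  by_contra hcn
  obtain ⟨σ, hσ, hσc⟩ := exists_aut _ _ hcn
  apply hσc
  have hσa : ∀ m, 1 ≤ m → σ (a m) = a m := fun m hm =>
    hσ _ (Subfield.subset_closure (Or.inl ⟨m, hm, rfl⟩))
  have hσz : σ (zetaC M) = zetaC M := hσ _ (Subfield.subset_closure (Or.inr rfl))
  haveI : NeZero N := ⟨by omega⟩
  obtain ⟨N', h'⟩ : ∃ N', N' = 4 * N := ⟨_, rfl⟩
  haveI : NeZero N' := ⟨by omega⟩
  have h4 : 4 ≤ N' := by omega
  have hd : N ∣ N' := ⟨4, by omega⟩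
  have hN' : 0 < N' := by omega
  obtain ⟨l, hl⟩ := sigma_unit N' σ
  have hF := sigma_f h4 hd hk f a ha σ hσa l hl
  obtain ⟨W, h1, h2⟩ := core k (fun v => ⇑f ∣[k] gof N' v) (fun v => qExpansion (N' : ℝ) (⇑f ∣[k] gof N' v))
    (fun v => slash_HE f _ N' hN' hd) (fam_slash hd f) σ l hl _ hF g
  have hmem := mem_lCD l g
  have hfg : (⇑f ∣[k] gof N' ((l : ZMod N') * (g 1 0 : ZMod N'), (g 1 1 : ZMod N'))) = ⇑f ∣[k] g := by
    apply slash_congr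
    have hb := brow_gof hmem
    set γ := gof N' ((l : ZMod N') * (g 1 0 : ZMod N'), (g 1 1 : ZMod N'))
    simp only [brow, Prod.mk.injEq] at hb ⊢
    refine ⟨lam_cond σ (g 1 0) M hM hσz N' h' l hl _ hb.1, ?_⟩
    have := congrArg (ZMod.castHom hd (ZMod N)) hb.2
    simpa using this
  simp only [hfg] at h2
  have hc' : HE N' (⇑f ∣[k] g) (PowerSeries.expand 4 (by norm_num) (PowerSeries.mk c)) := by
    rw [h']
    exact ((HE_iff _ _ _).1 hc).expand hN (by norm_num)
  have hq : qExpansion (N' : ℝ) (⇑f ∣[k] g) = PowerSeries.expand 4 (by norm_num) (PowerSeries.mk c) :=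
    (slash_HE f g N' hN' hd).unique hN' hc'
  rw [hq] at h2
  have hw : act (0, (l : ZMod N')) g ∈ VV N' := act_mem (by simpa using scale_mem l (mem01 N')) g
  have hW : DD (act (0, (l : ZMod N')) g) * (⟨(_, _), hc'⟩ : Good N') = W := by
    apply gF_inj hN'
    funext τ
    rw [map_mul]
    exact h1 τ
  have h3 := congrArg (gS N') hW
  rw [map_mul, h2] at h3
  have h5 : PowerSeries.expand 4 (by norm_num) (PowerSeries.mk c) =
      PowerSeries.map σ (PowerSeries.expand 4 (by norm_num) (PowerSeries.mk c)) :=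
    mul_left_cancel₀ (gS_DD_ne h4 hw) h3
  have h6 := congrArg (PowerSeries.coeff (4 * n)) h5
  rw [PowerSeries.coeff_map, PowerSeries.coeff_expand_mul, PowerSeries.coeff_mk] at h6
  exact h6.symm
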